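/- arXiv:1008.5241 — 2 statements merged into one kernel-verified Lean document; each statement's English description precedes it below -/
import Mathlib

section
/- Let N be a bounded normal operator on a Hilbert space H with spectrum σ = {0} ∪ {λₙ : n ≥ 1}, where λₙ > 0 and λₙ → 0. Let T be the operator on H ⊕ H given in block form by [[0, N^{1/2}], [0, N]]. Then the norm-closed algebra A_T generated by {Tᵏ : k ≥ 1} equals { [[0, f(N)], [0, N^{1/2} f(N)]] : f ∈ C(σ), f(0) = 0 }. -/
open ContinuousLinearMap in
/-- The block operator `[[A, B], [C, D]]` on `H ⊕ H`. -/
noncomputable def blockOp {H : Type*} [NormedAddCommGroup H] [InnerProductSpace ℂ H]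
    (A B C D : H →L[ℂ] H) : (H × H) →L[ℂ] (H × H) :=
  (A.comp (fst ℂ H H) + B.comp (snd ℂ H H)).prod (C.comp (fst ℂ H H) + D.comp (snd ℂ H H))

open ContinuousMap in
/-- On a compact set of real numbers, the products `s * p` with `p` a polynomial are dense in the
continuous functions vanishing at `0`, provided that `s` vanishes exactly at `0`. -/
theorem closure_span_mul_pow {σ : Set ℂ} [CompactSpace σ] (hreal : ∀ z ∈ σ, star z = z)
    (s : C(σ, ℂ)) (hs : ∀ z : σ, s z = 0 ↔ (z : ℂ) = 0) :
    closure (Submodule.span ℂ (Set.range fun k : ℕ => s * (restrict σ (.id ℂ)) ^ k) :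
        Set C(σ, ℂ)) = {f : C(σ, ℂ) | ∀ z : σ, (z : ℂ) = 0 → f z = 0} := by
  set X : C(σ, ℂ) := restrict σ (.id ℂ) with hX
  set M : Submodule ℂ C(σ, ℂ) := Submodule.span ℂ (Set.range fun k : ℕ => s * X ^ k) with hM
  have hXstar : star X = X := by
    ext z
    exact hreal z z.2
  have hpoly : ∀ p ∈ polynomialFunctions σ, s * p ∈ M := by
    rintro _ ⟨p, -, rfl⟩
    induction p using Polynomial.induction_on' with
    | add p q hp hq =>
      rw [map_add, mul_add]
      exact add_mem hp hq
    | monomial n a =>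
      have : s * (Polynomial.toContinuousMapOnAlgHom σ) (Polynomial.monomial n a)
          = a • (s * X ^ n) := by
        ext z
        simp [hX]
        ring
      exact this ▸ M.smul_mem a (Submodule.subset_span ⟨n, rfl⟩)
  have hstar : (polynomialFunctions σ).starClosure.toSubalgebra = polynomialFunctions σ := by
    have hX' : Polynomial.toContinuousMapOnAlgHom σ (Polynomial.X : Polynomial ℂ) = X := by
      ext z
      simp [hX]
    rw [polynomialFunctions.starClosure_eq_adjoin_X, StarAlgebra.adjoin_toSubalgebra,
      polynomialFunctions.eq_adjoin_X, hX', Set.star_singleton, hXstar, Set.union_self]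
  have hdense : ∀ f : C(σ, ℂ), f ∈ closure (polynomialFunctions σ : Set C(σ, ℂ)) := by
    intro f
    have h := polynomialFunctions.starClosure_topologicalClosure (𝕜 := ℂ) σ
    have hf : f ∈ (polynomialFunctions σ).starClosure.topologicalClosure := h ▸ trivial
    rw [← hstar]
    exact hf
  have hmul : ∀ f : C(σ, ℂ), s * f ∈ closure (M : Set C(σ, ℂ)) := fun f =>
    map_mem_closure (continuous_const_mul s) (hdense f) hpoly
  apply subset_antisymm
  · refine closure_minimal ?_ ?_
    · intro f hf z hz
      induction hf using Submodule.span_induction with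
      | mem x hx =>
        obtain ⟨k, rfl⟩ := hx
        simp [(hs z).2 hz]
      | zero => rfl
      | add x y _ _ hx hy => simp [hx, hy]
      | smul a x _ hx => simp [hx]
    · simp only [Set.ofPred_forall]
      exact isClosed_iInter fun z => isClosed_iInter fun _ =>
        isClosed_eq (continuous_eval_const z) continuous_const
  · intro f hf
    set I : Ideal C(σ, ℂ) := (Ideal.span {s}).closure with hI
    have hIclosed : IsClosed (I : Set C(σ, ℂ)) := by
      rw [hI, Ideal.coe_closure]
      exact isClosed_closure
    have hfI : f ∈ I := by
      rw [← idealOfSet_ofIdeal_isClosed hIclosed, mem_idealOfSet]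
      intro z hz
      refine hf z ((hs z).1 ?_)
      have := notMem_setOfIdeal.1 hz
      exact this (subset_closure (Ideal.mem_span_singleton_self s))
    have hsub : ((Ideal.span {s} : Ideal C(σ, ℂ)) : Set C(σ, ℂ)) ⊆ closure (M : Set _) := by
      intro g hg
      obtain ⟨c, rfl⟩ := Ideal.mem_span_singleton'.1 hg
      rw [mul_comm]
      exact hmul c
    exact closure_minimal hsub isClosed_closure hfI

section BlockOp

variable {H : Type*} [NormedAddCommGroup H] [InnerProductSpace ℂ H]

/-- The linear map `B ↦ [[0, B], [0, S * B]]`. -/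
noncomputable def blockColumn (S : H →L[ℂ] H) : (H →L[ℂ] H) →ₗ[ℂ] (H × H) →L[ℂ] (H × H) where
  toFun B := blockOp 0 B 0 (S * B)
  map_add' B C := by ext x <;> simp [blockOp]
  map_smul' a B := by ext x <;> simp [blockOp]

theorem isClosedEmbedding_blockColumn (S : H →L[ℂ] H) :
    Topology.IsClosedEmbedding (blockColumn S) := by
  have hcont : Continuous (blockColumn S) := by
    have : (blockColumn S : (H →L[ℂ] H) → (H × H) →L[ℂ] (H × H)) = fun B =>
        (((ContinuousLinearMap.id ℂ H).prod S).comp B).comp (ContinuousLinearMap.snd ℂ H H) := by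
      funext B
      ext x <;> simp [blockColumn, blockOp]
    rw [this]
    fun_prop
  refine Function.LeftInverse.isClosedEmbedding (f := fun R =>
    ((ContinuousLinearMap.fst ℂ H H).comp R).comp (ContinuousLinearMap.inr ℂ H H))
    (fun B => ?_) (by fun_prop) hcont
  ext x
  simp [blockColumn, blockOp]

theorem blockOp_pow_succ {S N : H →L[ℂ] H} (hS : S * S = N) (k : ℕ) :
    blockOp 0 S 0 N ^ (k + 1) = blockColumn S (S * N ^ k) := by
  induction k with
  | zero => simp [blockColumn, hS]
  | succ k ih =>
    have h : S * (S * N ^ k * N) = S * (S * N ^ k) * N := by simp only [mul_assoc]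
    rw [pow_succ, ih, pow_succ N k, ← mul_assoc S]
    ext x
    all_goals simp [blockColumn, blockOp]

end BlockOp

/-- A continuous complex square root on `{0} ∪ (0, ∞)`. -/
theorem continuousOn_cpow_half {σ : Set ℂ} (hσ : ∀ z ∈ σ, z = 0 ∨ 0 < z.re) :
    ContinuousOn (fun z : ℂ => z ^ (1 / 2 : ℂ)) σ := by
  intro z hz
  refine ContinuousAt.continuousWithinAt ?_
  rcases hσ z hz with rfl | h
  · exact (Complex.continuousAt_cpow_zero_of_re_pos (z := (1 / 2 : ℂ)) (by norm_num)).comp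
      (f := fun x : ℂ => (x, (1 / 2 : ℂ))) (by fun_prop)
  · exact continuousAt_id.cpow continuousAt_const (Or.inl h)

/-- For `T = [[0, N^{1/2}], [0, N]]`, the norm-closed algebra generated by the positive
powers of `T` is `{ [[0, f(N)], [0, N^{1/2} f(N)]] : f ∈ C(σ), f(0) = 0 }`. -/
theorem algebra_generated_by_T
    {H : Type*} [NormedAddCommGroup H] [InnerProductSpace ℂ H] [CompleteSpace H]
    (l : ℕ → ℝ) (hpos : ∀ n, 0 < l n)
    (hlim : Filter.Tendsto l Filter.atTop (nhds 0))
    (N : H →L[ℂ] H) (hN : IsStarNormal N)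
    (hspec : spectrum ℂ N = insert (0 : ℂ) (Set.range fun n => (l n : ℂ)))
    (sqrtN : H →L[ℂ] H) (hsqrt : sqrtN = cfc (fun z : ℂ => z ^ (1/2 : ℂ)) N)
    (T : (H × H) →L[ℂ] (H × H)) (hT : T = blockOp 0 sqrtN 0 N) :
    closure (Submodule.span ℂ {S : (H × H) →L[ℂ] (H × H) | ∃ k : ℕ, 1 ≤ k ∧ S = T ^ k} : Set _)
      = {S : (H × H) →L[ℂ] (H × H) | ∃ f : ℂ → ℂ, ContinuousOn f (spectrum ℂ N) ∧ f 0 = 0 ∧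
          S = blockOp 0 (cfc f N) 0 (sqrtN * cfc f N)} := by
  have hσ : ∀ z ∈ spectrum ℂ N, star z = z ∧ (z = 0 ∨ 0 < z.re) := by
    intro z hz
    rw [hspec] at hz
    rcases hz with rfl | ⟨n, rfl⟩
    · simp
    · exact ⟨Complex.conj_ofReal _, Or.inr (by simpa using hpos n)⟩
  have hzero : (0 : ℂ) ∈ spectrum ℂ N := hspec ▸ Set.mem_insert _ _
  have hcont := continuousOn_cpow_half fun z hz => (hσ z hz).2
  set s : C(spectrum ℂ N, ℂ) := ⟨_, hcont.domRestrict⟩ with hs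
  set X : C(spectrum ℂ N, ℂ) := ContinuousMap.restrict (spectrum ℂ N) (.id ℂ) with hX
  have hsN : cfcHom hN s = sqrtN := by rw [hsqrt, cfc_apply _ N hN hcont]
  have hXN : cfcHom hN X = N := cfcHom_id hN
  have hss : s * s = X := by
    ext z
    change (z : ℂ) ^ (1 / 2 : ℂ) * (z : ℂ) ^ (1 / 2 : ℂ) = z
    rw [← pow_two, one_div]
    exact Complex.cpow_nat_inv_pow (z : ℂ) two_ne_zero
  have hSS : sqrtN * sqrtN = N := by rw [← hsN, ← map_mul, hss, hXN]
  set Φ : C(spectrum ℂ N, ℂ) →ₗ[ℂ] (H × H) →L[ℂ] (H × H) :=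
    (blockColumn sqrtN).comp (cfcHom hN).toAlgHom.toLinearMap with hΦ
  have hΦapply : ∀ f, Φ f = blockOp 0 (cfcHom hN f) 0 (sqrtN * cfcHom hN f) := fun _ => rfl
  have hΦemb : Topology.IsClosedEmbedding Φ :=
    (isClosedEmbedding_blockColumn sqrtN).comp (cfcHom_isClosedEmbedding hN)
  have hgen : {S : (H × H) →L[ℂ] (H × H) | ∃ k : ℕ, 1 ≤ k ∧ S = T ^ k}
      = Φ '' Set.range fun k : ℕ => s * X ^ k := by
    have hpow : ∀ k : ℕ, Φ (s * X ^ k) = T ^ (k + 1) := by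
      intro k
      have h : cfcHom hN (s * X ^ k) = sqrtN * N ^ k := by rw [map_mul, map_pow, hsN, hXN]
      rw [hT, blockOp_pow_succ hSS, ← h]
      rfl
    ext S
    constructor
    · rintro ⟨k, hk, rfl⟩
      obtain ⟨m, rfl⟩ := Nat.exists_eq_add_of_le' hk
      exact ⟨_, ⟨m, rfl⟩, hpow m⟩
    · rintro ⟨_, ⟨k, rfl⟩, rfl⟩
      exact ⟨k + 1, Nat.le_add_left 1 k, hpow k⟩
  have hs0 : ∀ z : spectrum ℂ N, s z = 0 ↔ (z : ℂ) = 0 := by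
    intro z
    change (z : ℂ) ^ (1 / 2 : ℂ) = 0 ↔ _
    simp [Complex.cpow_eq_zero_iff]
  rw [hgen, Submodule.span_image, Submodule.map_coe, hΦemb.closure_image_eq,
    closure_span_mul_pow (fun z hz => (hσ z hz).1) s hs0]
  ext S
  constructor
  · rintro ⟨g, hg, rfl⟩
    have hext : ∀ z : spectrum ℂ N, Function.extend Subtype.val g 0 (z : ℂ) = g z :=
      Subtype.val_injective.extend_apply g 0
    refine ⟨Function.extend Subtype.val g 0, ?_, ?_, ?_⟩
    · rw [continuousOn_iff_continuous_domRestrict]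
      exact g.continuous.congr fun z => (hext z).symm
    · exact (hext ⟨0, hzero⟩).trans (hg ⟨0, hzero⟩ rfl)
    · rw [hΦapply, cfcHom_eq_cfc_extend 0 hN]
  · rintro ⟨f, hf, hf0, rfl⟩
    refine ⟨⟨_, hf.domRestrict⟩, fun z hz => ?_, ?_⟩
    · change f z = 0
      rw [hz, hf0]
    · rw [hΦapply, cfc_apply f N hN hf]
end

section
/- Let N be a bounded normal operator with spectrum σ = {0} ∪ {λₙ : n ≥ 1}, λₙ > 0, λₙ → 0, and let T = [[0, N^{1/2}], [0, N]]. Then the norm-closed algebra A_T generated by the positive powers of T is topologically generated by the idempotents Pₙ = [[0, hₙ(N)], [0, N^{1/2}hₙ(N)]], where hₙ(λₙ) = 1/√λₙ and hₙ = 0 elsewhere on σ. Consequently every continuous derivation from A_T into a commutative Banach A_T-bimodule is zero, i.e., T is weakly amenable. -/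
open Filter Topology

/-- The indicator of an isolated point of a set is continuous on that set. -/
theorem continuousOn_ite_eq_of_isolated {X Y : Type*} [TopologicalSpace X] [T1Space X]
    [DecidableEq X] [TopologicalSpace Y] {s : Set X} {a : X} (h : ∀ᶠ z in 𝓝[s] a, z = a) (c d : Y) :
    ContinuousOn (fun z => if z = a then c else d) s := by
  intro x _
  by_cases hxa : x = a
  · subst hxa
    refine (continuousWithinAt_const (b := c)).congr_of_eventuallyEq ?_ (by simp)
    filter_upwards [h] with z hz
    simp [hz]
  · refine (continuousWithinAt_const (b := d)).congr_of_eventuallyEq ?_ (by simp [hxa])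
    filter_upwards [mem_nhdsWithin_of_mem_nhds (isOpen_ne.mem_nhds hxa)] with z hz
    exact if_neg hz

theorem finite_setOf_le_of_tendsto_zero {l : ℕ → ℝ} (hlim : Tendsto l atTop (𝓝 0)) {ε : ℝ}
    (hε : 0 < ε) : {n | ε ≤ l n}.Finite := by
  have h := hlim.eventually (gt_mem_nhds hε)
  rw [← Nat.cofinite_eq_atTop] at h
  simpa [Filter.eventually_cofinite] using h

/-- Each positive term of a null sequence is isolated in the range of the sequence
together with `0`. -/
theorem eventually_eq_of_tendsto_zero {l : ℕ → ℝ} (hlim : Tendsto l atTop (𝓝 0)) {n : ℕ}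
    (hn : 0 < l n) :
    ∀ᶠ z in 𝓝[insert (0 : ℂ) (Set.range fun m => (l m : ℂ))] (l n : ℂ), z = (l n : ℂ) := by
  have hF := ((finite_setOf_le_of_tendsto_zero hlim (half_pos hn)).image
    (fun m => (l m : ℂ))).subset (Set.sdiff_subset (t := {(l n : ℂ)}))
  have h1 : ∀ᶠ z in 𝓝 (l n : ℂ), l n / 2 < z.re :=
    Complex.continuous_re.continuousAt.eventually (lt_mem_nhds (by simpa using half_lt_self hn))
  have h2 := hF.isClosed.isOpen_compl.mem_nhds (x := (l n : ℂ)) (by simp)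
  rw [eventually_nhdsWithin_iff]
  filter_upwards [h1, h2] with z hz hz' hzs
  by_contra hne
  rcases hzs with rfl | ⟨m, rfl⟩
  · simp at hz
    linarith
  · exact hz' ⟨⟨m, by simpa using hz.le, rfl⟩, hne⟩

theorem Complex.ofReal_cpow_half {x : ℝ} (hx : 0 ≤ x) :
    (x : ℂ) ^ (1 / 2 : ℂ) = (Real.sqrt x : ℂ) := by
  rw [Real.sqrt_eq_rpow, Complex.ofReal_cpow hx]
  simp

/-- The continuous functional calculus of a self-adjoint element lands in the closed
unital algebra generated by the element. -/
theorem cfc_mem_closure_algebra_adjoin {A : Type*} [CStarAlgebra A] {a : A}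
    (ha : IsSelfAdjoint a) (f : ℂ → ℂ) :
    cfc f a ∈ closure (Algebra.adjoin ℂ {a} : Set A) := by
  have h : cfc f a ∈ StarAlgebra.elemental ℂ a := cfc_mem_elemental f a
  have h' : (StarAlgebra.adjoin ℂ {a}).toSubalgebra = Algebra.adjoin ℂ {a} := by
    rw [StarAlgebra.adjoin_toSubalgebra, Set.star_singleton, ha.star_eq, Set.union_self]
  rw [← h']
  exact h

/-- The value `d = e d + e d` of a derivation into a commutative bimodule at an idempotent,
acting on the module as `e`, is zero. -/
theorem eq_zero_of_isIdempotentElem_of_eq_add {X : Type*} [AddCommGroup X] [Module ℂ X]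
    (e : X →ₗ[ℂ] X) (he : ∀ x, e (e x) = e x) {d : X} (hd : d = e d + e d) : d = 0 := by
  have h : e d = e d + e d := by
    conv_lhs => rw [hd]
    rw [map_add, he]
  have h0 : e d = 0 := by simpa using h
  rw [hd, h0, add_zero]

theorem ContinuousLinearMap.isSemitopologicalSemiring (E : Type*) [NormedAddCommGroup E]
    [NormedSpace ℂ E] : IsSemitopologicalSemiring (E →L[ℂ] E) :=
  inferInstance

section ColumnOperator

variable {H : Type*} [NormedAddCommGroup H] [InnerProductSpace ℂ H]

instance : IsSemitopologicalSemiring ((H × H) →L[ℂ] (H × H)) :=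
  ContinuousLinearMap.isSemitopologicalSemiring (H × H)

/-- The block operators `[[0, A], [0, S A]]`, as a continuous linear function of `A`. -/
noncomputable def columnOp (S : H →L[ℂ] H) : (H →L[ℂ] H) →L[ℂ] (H × H) →L[ℂ] (H × H) :=
  (ContinuousLinearMap.compL ℂ (H × H) H (H × H)
      ((ContinuousLinearMap.id ℂ H).prod S)).comp
    ((ContinuousLinearMap.compL ℂ (H × H) H H).flip (ContinuousLinearMap.snd ℂ H H))

theorem columnOp_apply (S A : H →L[ℂ] H) : columnOp S A = blockOp 0 A 0 (S * A) := by
  ext x <;> simp [columnOp, blockOp]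

theorem columnOp_mul (S A B : H →L[ℂ] H) :
    columnOp S A * columnOp S B = columnOp S (A * S * B) := by
  ext x <;> simp [columnOp]

/-- If `B` is a limit of polynomials in `S * S`, then
`[[0, S B], [0, S S B]]` is in the closed algebra generated by `[[0, S], [0, S S]]`. -/
theorem columnOp_mul_mem_closure_adjoin {S B : H →L[ℂ] H}
    (hB : B ∈ closure (Algebra.adjoin ℂ {S * S} : Set (H →L[ℂ] H))) :
    columnOp S (S * B) ∈ (NonUnitalAlgebra.adjoin ℂ {columnOp S S}).topologicalClosure := by
  have key : ∀ B ∈ Algebra.adjoin ℂ {S * S}, ∀ C,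
      columnOp S (S * C) ∈ NonUnitalAlgebra.adjoin ℂ {columnOp S S} →
      columnOp S (S * (B * C)) ∈ NonUnitalAlgebra.adjoin ℂ {columnOp S S} := by
    intro B hB
    induction hB using Algebra.adjoin_induction with
    | mem x hx =>
      intro C hC
      rw [Set.mem_singleton_iff.1 hx]
      have := mul_mem (NonUnitalAlgebra.self_mem_adjoin_singleton ℂ (columnOp S S)) hC
      rwa [columnOp_mul, ← mul_assoc, mul_assoc S S S, mul_assoc S (S * S) C] at this
    | algebraMap r =>
      intro C hC
      rw [← Algebra.smul_def, mul_smul_comm, map_smul]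
      exact SMulMemClass.smul_mem r hC
    | add x y _ _ hx hy =>
      intro C hC
      rw [add_mul, mul_add, map_add]
      exact add_mem (hx C hC) (hy C hC)
    | mul x y _ _ hx hy =>
      intro C hC
      rw [mul_assoc]
      exact hx _ (hy C hC)
  refine map_mem_closure (f := fun B => columnOp S (S * B)) (by fun_prop) hB fun B hB => ?_
  have := key B hB 1 (by simp)
  simpa using this

end ColumnOperator

/-- The norm-closed algebra generated by the positive powers of `T = [[0,N^{1/2}],[0,N]]`
is topologically generated by the idempotents `Pₙ = [[0, hₙ(N)], [0, N^{1/2}hₙ(N)]]`, and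
consequently every continuous derivation from it into a commutative Banach bimodule is
zero, i.e. `T` is weakly amenable. -/
theorem T_weakly_amenable
    {H : Type*} [NormedAddCommGroup H] [InnerProductSpace ℂ H] [CompleteSpace H]
    (l : ℕ → ℝ) (hpos : ∀ n, 0 < l n)
    (hlim : Filter.Tendsto l Filter.atTop (nhds 0))
    (N : H →L[ℂ] H) (hN : IsStarNormal N)
    (hspec : spectrum ℂ N = insert (0 : ℂ) (Set.range fun n => (l n : ℂ)))
    (sqrtN : H →L[ℂ] H) (hsqrt : sqrtN = cfc (fun z : ℂ => z ^ (1/2 : ℂ)) N)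
    (T : (H × H) →L[ℂ] (H × H)) (hT : T = blockOp 0 sqrtN 0 N)
    (P : ℕ → ((H × H) →L[ℂ] (H × H)))
    (hP : ∀ n, P n =
      blockOp 0 (cfc (fun z : ℂ => if z = (l n : ℂ) then ((Real.sqrt (l n))⁻¹ : ℂ) else 0) N)
        0 (sqrtN * cfc (fun z : ℂ => if z = (l n : ℂ) then ((Real.sqrt (l n))⁻¹ : ℂ) else 0) N))
    -- `AT` is the norm-closed (non-unital) subalgebra generated by `T`,
    -- i.e. the closure of the span of the positive powers of `T`
    (AT : NonUnitalSubalgebra ℂ ((H × H) →L[ℂ] (H × H)))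
    (hAT : (AT : Set ((H × H) →L[ℂ] (H × H)))
      = closure (NonUnitalAlgebra.adjoin ℂ {T} : Set ((H × H) →L[ℂ] (H × H)))) :
    -- `AT` is topologically generated by the idempotents `Pₙ`
    (AT : Set ((H × H) →L[ℂ] (H × H)))
      = closure (NonUnitalAlgebra.adjoin ℂ (Set.range P) : Set ((H × H) →L[ℂ] (H × H))) ∧
    -- every continuous derivation from `AT` into a commutative Banach bimodule is zero
    (∀ (X : Type) (_ : NormedAddCommGroup X) (_ : NormedSpace ℂ X) (_ : CompleteSpace X)
      (L R : ↥AT →L[ℂ] X →L[ℂ] X),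
      (∀ a b x, L (a * b) x = L a (L b x)) →
      (∀ a b x, R (a * b) x = R b (R a x)) →
      (∀ a b x, R b (L a x) = L a (R b x)) →
      (∀ a x, L a x = R a x) →
      ∀ (D : ↥AT →L[ℂ] X), (∀ a b, D (a * b) = L a (D b) + R b (D a)) → D = 0) := by
  have hσ : ∀ z ∈ spectrum ℂ N, ∃ x : ℝ, 0 ≤ x ∧ z = x := by
    rw [hspec]
    rintro z (rfl | ⟨n, rfl⟩)
    · exact ⟨0, le_rfl, by simp⟩
    · exact ⟨l n, (hpos n).le, rfl⟩
  have hcsqrt : ContinuousOn (fun z : ℂ => z ^ (1/2 : ℂ)) (spectrum ℂ N) := by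
    refine ContinuousOn.congr (f := fun z : ℂ => (Real.sqrt z.re : ℂ)) (by fun_prop) ?_
    intro z hz
    obtain ⟨x, hx, rfl⟩ := hσ z hz
    simpa using Complex.ofReal_cpow_half hx
  have hcite : ∀ n (c : ℂ),
      ContinuousOn (fun z : ℂ => if z = (l n : ℂ) then c else 0) (spectrum ℂ N) := by
    intro n c
    rw [hspec]
    exact continuousOn_ite_eq_of_isolated (eventually_eq_of_tendsto_zero hlim (hpos n)) c 0
  have hsa : IsSelfAdjoint N := by
    rw [isSelfAdjoint_iff, ← cfc_star_id (R := ℂ) N]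
    conv_rhs => rw [← cfc_id ℂ N]
    refine cfc_congr fun z hz => ?_
    obtain ⟨x, _, rfl⟩ := hσ z hz
    simp
  have hss : sqrtN * sqrtN = N := by
    rw [hsqrt, ← cfc_mul _ _ N hcsqrt hcsqrt]
    conv_rhs => rw [← cfc_id ℂ N]
    refine cfc_congr fun z hz => ?_
    obtain ⟨x, hx, rfl⟩ := hσ z hz
    simp only [Complex.ofReal_cpow_half hx, id]
    exact_mod_cast Real.mul_self_sqrt hx
  have hT' : T = columnOp sqrtN sqrtN := by rw [hT, columnOp_apply, hss]
  have hPcol : ∀ n, P n = columnOp sqrtN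
      (cfc (fun z : ℂ => if z = (l n : ℂ) then ((Real.sqrt (l n))⁻¹ : ℂ) else 0) N) := by
    intro n
    rw [hP, columnOp_apply]
  have hroot : ∀ n, (Real.sqrt (l n) : ℂ) ≠ 0 := fun n =>
    Complex.ofReal_ne_zero.2 (Real.sqrt_pos.2 (hpos n)).ne'
  have hPidem : ∀ n, P n * P n = P n := by
    intro n
    rw [hPcol, columnOp_mul, hsqrt, ← cfc_mul _ _ N (hcite n _) hcsqrt,
      ← cfc_mul (fun z : ℂ => (if z = (l n : ℂ) then ((Real.sqrt (l n))⁻¹ : ℂ) else 0) *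
        z ^ (1/2 : ℂ)) _ N ((hcite n _).mul hcsqrt) (hcite n _)]
    congr 1
    refine cfc_congr fun z _ => ?_
    by_cases hz : z = l n
    · simp only [hz, if_true, Complex.ofReal_cpow_half (hpos n).le]
      field_simp [hroot n]
    · simp [hz]
  have hPmem : ∀ n, P n ∈ (NonUnitalAlgebra.adjoin ℂ {T}).topologicalClosure := by
    intro n
    have hB := cfc_mem_closure_algebra_adjoin hsa
      (fun z : ℂ => if z = (l n : ℂ) then ((l n : ℂ))⁻¹ else 0)
    rw [← hss] at hB
    have := columnOp_mul_mem_closure_adjoin hB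
    rw [hss] at this
    rw [hT', hPcol]
    convert this using 2
    rw [hsqrt, ← cfc_mul _ _ N hcsqrt (hcite n _)]
    refine cfc_congr fun z _ => ?_
    by_cases hz : z = l n
    · simp only [hz, if_true, Complex.ofReal_cpow_half (hpos n).le]
      have h1 := hroot n
      have h2 : (l n : ℂ) = Real.sqrt (l n) * Real.sqrt (l n) := by
        exact_mod_cast (Real.mul_self_sqrt (hpos n).le).symm
      rw [h2]
      field_simp
    · simp [hz]
  have hTmem : T ∈ (NonUnitalAlgebra.adjoin ℂ (Set.range P)).topologicalClosure := by
    have hs : sqrtN ∈ closure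
        {A | columnOp sqrtN A ∈ NonUnitalAlgebra.adjoin ℂ (Set.range P)} := by
      rw [Metric.mem_closure_iff]
      intro ε hε
      have hδ : 0 < (ε / 2) ^ 2 := by positivity
      set F := (finite_setOf_le_of_tendsto_zero hlim hδ).toFinset with hF
      set V := F.image l with hV
      set g : ℝ → ℂ → ℂ := fun v z => if z = (v : ℂ) then (Real.sqrt v : ℂ) else 0 with hg
      have hgc : ∀ v ∈ V, ContinuousOn (g v) (spectrum ℂ N) := by
        intro v hv
        obtain ⟨n, _, rfl⟩ := Finset.mem_image.1 hv
        exact hcite n _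
      have hsumc : ContinuousOn (∑ v ∈ V, g v) (spectrum ℂ N) := by
        have := continuousOn_finsetSum V hgc
        convert this using 1
        ext z
        simp
      refine ⟨cfc (∑ v ∈ V, g v) N, ?_, ?_⟩
      · rw [Set.mem_ofPred_eq, cfc_sum g N V hgc, map_sum]
        refine sum_mem fun v hv => ?_
        obtain ⟨n, _, rfl⟩ := Finset.mem_image.1 hv
        have : columnOp sqrtN (cfc (g (l n)) N) = (l n : ℂ) • P n := by
          rw [hPcol, ← map_smul, ← cfc_smul _ _ N (hcite n _)]
          congr 1
          refine cfc_congr fun z _ => ?_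
          by_cases hz : z = l n
          · have h1 := hroot n
            have h2 : (l n : ℂ) = Real.sqrt (l n) * Real.sqrt (l n) := by
              exact_mod_cast (Real.mul_self_sqrt (hpos n).le).symm
            simp only [hg, hz, if_true, smul_eq_mul]
            rw [eq_mul_inv_iff_mul_eq₀ h1, h2]
          · simp [hg, hz]
        rw [this]
        exact SMulMemClass.smul_mem _ (NonUnitalAlgebra.subset_adjoin ℂ ⟨n, rfl⟩)
      · rw [dist_eq_norm, hsqrt, ← cfc_sub _ _ N hcsqrt hsumc]
        refine (norm_cfc_le (half_pos hε).le fun z hz => ?_).trans_lt (half_lt_self hε)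
        obtain ⟨x, hx, rfl⟩ := hσ z hz
        have hsum : (∑ v ∈ V, g v) (x : ℂ) = if x ∈ V then (Real.sqrt x : ℂ) else 0 := by
          simp [hg, Finset.sum_apply, Complex.ofReal_inj]
        rw [hsum, Complex.ofReal_cpow_half hx]
        split_ifs with hxV
        · simpa using (half_pos hε).le
        · rw [sub_zero, Complex.norm_real, Real.norm_of_nonneg (Real.sqrt_nonneg x)]
          rw [hspec] at hz
          rcases hz with hz | ⟨n, hn⟩
          · rw [Complex.ofReal_eq_zero.1 hz, Real.sqrt_zero]
            exact (half_pos hε).le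
          · have hn' : l n = x := Complex.ofReal_injective hn
            rw [Real.sqrt_le_left (half_pos hε).le]
            by_contra! hlt
            exact hxV (Finset.mem_image.2 ⟨n, by simpa [hF, hn'] using hlt.le, hn'⟩)
    rw [hT']
    exact map_mem_closure (columnOp sqrtN).continuous hs fun A hA => hA
  have hclosure : (AT : Set ((H × H) →L[ℂ] (H × H)))
      = closure (NonUnitalAlgebra.adjoin ℂ (Set.range P) : Set ((H × H) →L[ℂ] (H × H))) := by
    rw [hAT]
    refine Set.Subset.antisymm ?_ ?_
    · exact NonUnitalSubalgebra.topologicalClosure_minimal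
        (NonUnitalAlgebra.adjoin_le (Set.singleton_subset_iff.2 hTmem))
        (NonUnitalSubalgebra.isClosed_topologicalClosure _)
    · exact NonUnitalSubalgebra.topologicalClosure_minimal
        (NonUnitalAlgebra.adjoin_le (Set.range_subset_iff.2 hPmem))
        (NonUnitalSubalgebra.isClosed_topologicalClosure _)
  refine ⟨hclosure, ?_⟩
  intro X _ _ _ L R hL _ _ hLR D hD
  have hsub : ∀ a ∈ NonUnitalAlgebra.adjoin ℂ (Set.range P), a ∈ AT := fun a ha => by
    rw [← SetLike.mem_coe, hclosure]
    exact subset_closure ha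
  have hzero : ∀ a (ha : a ∈ NonUnitalAlgebra.adjoin ℂ (Set.range P)),
      D ⟨a, hsub a ha⟩ = 0 := by
    intro a ha
    induction ha using NonUnitalAlgebra.adjoin_induction with
    | mem x hx =>
      obtain ⟨n, rfl⟩ := hx
      set e : AT := ⟨P n, hsub _ (NonUnitalAlgebra.subset_adjoin ℂ ⟨n, rfl⟩)⟩
      have he : e * e = e := Subtype.ext (hPidem n)
      refine eq_zero_of_isIdempotentElem_of_eq_add (L e : X →ₗ[ℂ] X) (fun x => ?_) ?_
      · simpa [he] using (hL e e x).symm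
      · simpa [he, hLR] using hD e e
    | zero => exact map_zero D
    | add x y hx hy hx' hy' =>
      have := map_add D ⟨x, hsub x hx⟩ ⟨y, hsub y hy⟩
      rwa [hx', hy', add_zero] at this
    | mul x y hx hy hx' hy' =>
      have := hD ⟨x, hsub x hx⟩ ⟨y, hsub y hy⟩
      rwa [hx', hy', map_zero, map_zero, add_zero] at this
    | smul r x hx hx' =>
      have := map_smul D r ⟨x, hsub x hx⟩
      rwa [hx', smul_zero] at this
  ext a
  have ha : a ∈ closure {b : AT | (b : (H × H) →L[ℂ] (H × H)) ∈
      NonUnitalAlgebra.adjoin ℂ (Set.range P)} := by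
    rw [closure_subtype]
    have := a.2
    rw [← SetLike.mem_coe, hclosure] at this
    refine closure_mono (fun b hb => ?_) this
    exact ⟨⟨b, hsub b hb⟩, hb, rfl⟩
  have hker : IsClosed {b : AT | D b = 0} := isClosed_eq D.continuous continuous_const
  exact closure_minimal (t := {b : AT | D b = 0}) (fun b hb => hzero b hb) hker ha
end
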